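/- Let Ω ⊆ ℝ³ be a bounded open set, ξ ∈ Ω, H a regular part of the Green's function of Ω at ξ (H continuous on the closure of Ω, Δ_ℍ H = 0 on Ω, H = Γ_ξ on ∂Ω), and G_ξ = Γ_ξ − H. For τ > 0 let Ω(τ) = {ξ} ∪ {η ∈ Ω ∖ {ξ} : G_ξ(η) > τ}, and suppose ∂Ω(τ) is nonempty. Then α_{Ω(τ)}(ξ) ≤ α_Ω(ξ), where for a set A with ξ in its interior, α_A(ξ) = (sup_{η∈∂A} d(ξ,η))/(inf_{η∈∂A} d(ξ,η)). -/

import Mathlib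

open MeasureTheory Real Set

noncomputable section

/-- The underlying space of the Heisenberg group ℍ¹: ℝ³ with coordinates (x, y, t). -/
abbrev H1 : Type := ℝ × ℝ × ℝ

/-- The Koranyi norm ρ(x,y,t) = ((x²+y²)² + t²)^{1/4}. -/
def ρH (η : H1) : ℝ := ((η.1 ^ 2 + η.2.1 ^ 2) ^ 2 + η.2.2 ^ 2) ^ ((1 : ℝ) / 4)

/-- The Heisenberg group law: η∘ξ = (x+x₀, y+y₀, t+t₀+2(x₀y − x y₀)). -/
def hmul (η ξ : H1) : H1 :=
  (η.1 + ξ.1, η.2.1 + ξ.2.1, η.2.2 + ξ.2.2 + 2 * (ξ.1 * η.2.1 - η.1 * ξ.2.1))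

/-- The Heisenberg group inverse: ξ⁻¹ = (−x₀,−y₀,−t₀). -/
def hinv (ξ : H1) : H1 := (-ξ.1, -ξ.2.1, -ξ.2.2)

/-- The Koranyi distance d(ξ,η) = ρ(ξ⁻¹∘η). -/
def kd (ξ η : H1) : ℝ := ρH (hmul (hinv ξ) η)

/-- The Koranyi ball B(ξ,r) = {η : d(ξ,η) < r}. -/
def kball (ξ : H1) (r : ℝ) : Set H1 := {η | kd ξ η < r}

/-- Horizontal derivative Xu = ∂u/∂x + 2y·∂u/∂t, as the derivative along (1,0,2y). -/
def Xd (u : H1 → ℝ) (η : H1) : ℝ := fderiv ℝ u η (1, 0, 2 * η.2.1)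

/-- Horizontal derivative Yu = ∂u/∂y − 2x·∂u/∂t, as the derivative along (0,1,−2x). -/
def Yd (u : H1 → ℝ) (η : H1) : ℝ := fderiv ℝ u η (0, 1, -2 * η.1)

/-- The Kohn-Laplacian Δ_ℍ u = X(Xu) + Y(Yu). -/
def kohn (u : H1 → ℝ) (η : H1) : ℝ := Xd (Xd u) η + Yd (Yd u) η

/-- The fundamental solution with pole ξ: Γ_ξ(η) = 1/(8π d(ξ,η)²). -/
def Γξ (ξ η : H1) : ℝ := 1 / (8 * π * kd ξ η ^ 2)

/-- A set A satisfies the uniform exterior ball property if there exists r₀ > 0 such that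
for every ζ ∈ ∂A and every r ∈ (0,r₀] there exists η with B(η,r) ∩ A = ∅ and ζ ∈ ∂B(η,r). -/
def uebp (A : Set H1) : Prop :=
  ∃ r₀ > (0 : ℝ), ∀ ζ ∈ frontier A, ∀ r : ℝ, 0 < r → r ≤ r₀ →
    ∃ η : H1, kball η r ∩ A = ∅ ∧ ζ ∈ frontier (kball η r)

/-- Ω has C¹ boundary: it is the sublevel set of a C¹ defining function with
nonvanishing gradient on the boundary. -/
def c1Bdry (Ω : Set H1) : Prop :=
  ∃ f : H1 → ℝ, ContDiff ℝ 1 f ∧ Ω = {x | f x < 0} ∧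
    frontier Ω = {x | f x = 0} ∧ ∀ x ∈ frontier Ω, fderiv ℝ f x ≠ 0

/-- Ω has smooth boundary: it is the sublevel set of a smooth defining function with
nonvanishing gradient on the boundary. -/
def smoothBdry (Ω : Set H1) : Prop :=
  ∃ f : H1 → ℝ, ContDiff ℝ (⊤ : ℕ∞) f ∧ Ω = {x | f x < 0} ∧
    frontier Ω = {x | f x = 0} ∧ ∀ x ∈ frontier Ω, fderiv ℝ f x ≠ 0

/-- The horizontal perimeter of Ω:
P_ℍ(Ω) = sup { ∫_Ω (Xa + Yb) : a,b of class C¹ with a²+b² ≤ 1 }. -/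
def horizPerim (Ω : Set H1) : ℝ :=
  sSup { p : ℝ | ∃ a b : H1 → ℝ, ContDiff ℝ 1 a ∧ ContDiff ℝ 1 b ∧
    (∀ η, a η ^ 2 + b η ^ 2 ≤ 1) ∧ p = ∫ η in Ω, (Xd a η + Yd b η) }

/-- The first Dirichlet eigenvalue of the Kohn-Laplacian on Ω, via the Rayleigh quotient. -/
def lam1 (Ω : Set H1) : ℝ :=
  sInf { q : ℝ | ∃ v : H1 → ℝ, ContDiff ℝ (⊤ : ℕ∞) v ∧ HasCompactSupport v ∧ tsupport v ⊆ Ω ∧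
    v ≠ 0 ∧ q = (∫ η in Ω, ((Xd v η) ^ 2 + (Yd v η) ^ 2)) / (∫ η in Ω, (v η) ^ 2) }

/-- The Bessel function of the first kind of order 1,
J₁(l) = (l/2)·Σ_{k=0}^∞ ((−1)^k/(k!·(k+1)!))·(l/2)^{2k}. -/
def J1 (l : ℝ) : ℝ :=
  (l / 2) * ∑' k : ℕ,
    ((-1 : ℝ) ^ k / ((Nat.factorial k : ℝ) * (Nat.factorial (k + 1) : ℝ))) * (l / 2) ^ (2 * k)

open Filter Topology in
/-- Second derivative test: the second derivative at a local maximum is nonpositive. -/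
theorem IsLocalMax.second_deriv_nonpos {g g₁ : ℝ → ℝ} {g₂ s : ℝ} (hmax : IsLocalMax g s)
    (hg : ∀ᶠ r in 𝓝 s, HasDerivAt g (g₁ r) r) (hg₁ : HasDerivAt g₁ g₂ s) : g₂ ≤ 0 := by
  by_contra! hpos
  have hd : deriv g =ᶠ[𝓝 s] g₁ := hg.mono fun r hr => hr.deriv
  have hdd : deriv (deriv g) s = g₂ := hd.deriv_eq.trans hg₁.deriv
  have hmin : IsLocalMin g s :=
    isLocalMin_of_deriv_deriv_pos (hdd ▸ hpos) hmax.deriv_eq_zero hg.self_of_nhds.continuousAt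
  have hconst : g =ᶠ[𝓝 s] fun _ => g s := by
    filter_upwards [hmin, hmax] with r h₁ h₂ using le_antisymm h₂ h₁
  have hzero : deriv g =ᶠ[𝓝 s] fun _ => 0 := by
    filter_upwards [hconst.eventuallyEq_nhds] with r hr
    rw [hr.deriv_eq, deriv_const]
  have := hzero.deriv_eq
  rw [deriv_const, hdd] at this
  exact hpos.ne' this

open Filter Topology in
theorem eventually_hasDerivAt_along_line {u : H1 → ℝ} {p v : H1} (hu : ContDiffAt ℝ 2 u p) :
    ∀ᶠ s : ℝ in 𝓝 0, HasDerivAt (fun s : ℝ => u (p + s • v)) (fderiv ℝ u (p + s • v) v) s := by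
  have hline : Tendsto (fun s : ℝ => p + s • v) (𝓝 0) (𝓝 p) := by
    have : ContinuousAt (fun s : ℝ => p + s • v) 0 := by fun_prop
    simpa [ContinuousAt] using this
  have hev : ∀ᶠ q in 𝓝 p, DifferentiableAt ℝ u q := by
    filter_upwards [hu.eventually (by simp)] with q hq using hq.differentiableAt (by simp)
  filter_upwards [hline.eventually hev] with s hs
  have hl : HasDerivAt (fun s : ℝ => p + s • v) v s := by
    simpa using ((hasDerivAt_id s).smul_const v).const_add p
  exact hs.hasFDerivAt.comp_hasDerivAt s hl

theorem hasDerivAt_comp_line {w : H1 → ℝ} {p : H1} (v : H1) (hw : DifferentiableAt ℝ w p) :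
    HasDerivAt (fun s : ℝ => w (p + s • v)) (fderiv ℝ w p v) 0 := by
  have hl : HasDerivAt (fun s : ℝ => p + s • v) v 0 := by
    simpa using ((hasDerivAt_id (0 : ℝ)).smul_const v).const_add p
  have hw' : HasFDerivAt w (fderiv ℝ w p) (p + (0 : ℝ) • v) := by simpa using hw.hasFDerivAt
  exact hw'.comp_hasDerivAt 0 hl

theorem ContDiffAt.differentiableAt_fderiv_two {u : H1 → ℝ} {p : H1} (hu : ContDiffAt ℝ 2 u p) :
    DifferentiableAt ℝ (fderiv ℝ u) p :=
  (hu.fderiv_right (m := 1) (by norm_num)).differentiableAt (by simp)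

open Filter Topology in
theorem IsLocalMax.comp_line {w : H1 → ℝ} {p : H1} (hw : IsLocalMax w p) (v : H1) :
    IsLocalMax (fun s : ℝ => w (p + s • v)) 0 := by
  have hline : Tendsto (fun s : ℝ => p + s • v) (𝓝 0) (𝓝 p) := by
    have : ContinuousAt (fun s : ℝ => p + s • v) 0 := by fun_prop
    simpa [ContinuousAt] using this
  simpa [IsLocalMax, IsMaxFilter] using hline.eventually hw

/-- At a local maximum of `u + ε x²` the Kohn-Laplacian of `u` is at most `-2 ε`. -/
theorem kohn_le_of_isLocalMax_add_sq {u : H1 → ℝ} {p : H1} {ε : ℝ} (hu : ContDiffAt ℝ 2 u p)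
    (hmax : IsLocalMax (fun η => u η + ε * η.1 ^ 2) p) : kohn u p ≤ -2 * ε := by
  have hdf := hu.differentiableAt_fderiv_two
  have hX : Xd (Xd u) p + 2 * ε ≤ 0 := by
    have hline := hmax.comp_line ((1, 0, 2 * p.2.1) : H1)
    have hq : ∀ s : ℝ, HasDerivAt
        (fun s : ℝ => ε * (p + s • ((1, 0, 2 * p.2.1) : H1)).1 ^ 2) (ε * (2 * (p.1 + s))) s := by
      intro s
      have := ((((hasDerivAt_id s).const_add p.1).pow 2).const_mul ε)
      simpa using this
    have hq₁ : HasDerivAt (fun s : ℝ => ε * (2 * (p.1 + s))) (2 * ε) 0 := by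
      have := (((hasDerivAt_id (0 : ℝ)).const_add p.1).const_mul 2).const_mul ε
      simpa [mul_comm] using this
    have hw : DifferentiableAt ℝ (Xd u) p := by unfold Xd; fun_prop
    refine hline.second_deriv_nonpos
      (g₁ := fun s => Xd u (p + s • ((1, 0, 2 * p.2.1) : H1)) + ε * (2 * (p.1 + s))) ?_
      ((hasDerivAt_comp_line _ hw).add hq₁)
    filter_upwards [eventually_hasDerivAt_along_line (v := ((1, 0, 2 * p.2.1) : H1)) hu] with s hs
    have := hs.fun_add (hq s)
    simpa [Xd] using this
  have hY : Yd (Yd u) p ≤ 0 := by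
    have hline := hmax.comp_line ((0, 1, -2 * p.1) : H1)
    have hw : DifferentiableAt ℝ (Yd u) p := by unfold Yd; fun_prop
    refine hline.second_deriv_nonpos
      (g₁ := fun s => Yd u (p + s • ((0, 1, -2 * p.1) : H1))) ?_ (hasDerivAt_comp_line _ hw)
    filter_upwards [eventually_hasDerivAt_along_line (v := ((0, 1, -2 * p.1) : H1)) hu] with s hs
    have := hs.add_const (ε * p.1 ^ 2)
    simpa [Yd] using this
  unfold kohn
  linarith

/-- Weak maximum principle for the Kohn-Laplacian. -/
theorem le_of_kohn_nonneg {Ω : Set H1} (hΩo : IsOpen Ω) (hΩb : Bornology.IsBounded Ω)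
    {u : H1 → ℝ} (huc : ContinuousOn u (closure Ω)) (hud : ContDiffOn ℝ 2 u Ω)
    (huh : ∀ η ∈ Ω, 0 ≤ kohn u η) {C : ℝ} (huC : ∀ η ∈ frontier Ω, u η ≤ C) :
    ∀ η ∈ Ω, u η ≤ C := by
  intro η hη
  have hK : IsCompact (closure Ω) := hΩb.isCompact_closure
  obtain ⟨R, hR⟩ := hK.exists_bound_of_continuousOn
    (f := fun q : H1 => q.1 ^ 2) (by fun_prop)
  have hR' : ∀ q ∈ closure Ω, q.1 ^ 2 ≤ R := fun q hq => (le_abs_self _).trans (hR q hq)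
  have hR0 : 0 ≤ R := (sq_nonneg η.1).trans (hR' η (subset_closure hη))
  have key : ∀ ε > 0, u η ≤ C + ε * R := by
    intro ε hε
    obtain ⟨p, hp, hpmax⟩ := hK.exists_isMaxOn ⟨η, subset_closure hη⟩
      (f := fun q => u q + ε * q.1 ^ 2) (huc.add (by fun_prop))
    have hηp : u η + ε * η.1 ^ 2 ≤ u p + ε * p.1 ^ 2 := hpmax (subset_closure hη)
    have hpΩ : p ∉ Ω := by
      intro hpΩ
      have hmem := hΩo.mem_nhds hpΩ
      have := kohn_le_of_isLocalMax_add_sq (hud.contDiffAt hmem)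
        (hpmax.isLocalMax (Filter.mem_of_superset hmem subset_closure))
      linarith [huh p hpΩ]
    have hpC := huC p (hΩo.frontier_eq ▸ ⟨hp, hpΩ⟩)
    have := mul_le_mul_of_nonneg_left (hR' p hp) hε.le
    nlinarith [mul_nonneg hε.le (sq_nonneg η.1)]
  refine le_of_forall_pos_le_add fun δ hδ => (key (δ / (R + 1)) (by positivity)).trans ?_
  have : δ / (R + 1) * R ≤ δ := by
    rw [div_mul_eq_mul_div, div_le_iff₀ (by positivity)]
    nlinarith
  linarith

theorem kohn_neg (u : H1 → ℝ) (η : H1) : kohn (fun q => -u q) η = -kohn u η := by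
  have hX : ∀ w : H1 → ℝ, Xd (fun q => -w q) = fun q => -Xd w q := by
    intro w; funext q; simp [Xd, fderiv_fun_neg]
  have hY : ∀ w : H1 → ℝ, Yd (fun q => -w q) = fun q => -Yd w q := by
    intro w; funext q; simp [Yd, fderiv_fun_neg]
  simp only [kohn, hX, hY]
  ring

@[fun_prop]
theorem continuous_kd (ξ : H1) : Continuous (kd ξ) := by
  unfold kd ρH hmul hinv
  exact Continuous.rpow_const (by fun_prop) fun _ => Or.inr (by norm_num)

theorem kd_pos {ξ η : H1} (h : η ≠ ξ) : 0 < kd ξ η := by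
  unfold kd ρH
  refine rpow_pos_of_pos ?_ _
  by_contra! hle
  refine h ?_
  simp only [hmul, hinv] at hle
  have h₁ : (-ξ.1 + η.1) ^ 2 + (-ξ.2.1 + η.2.1) ^ 2 = 0 := by
    refine pow_eq_zero_iff two_ne_zero |>.1 (le_antisymm ?_ (sq_nonneg _))
    nlinarith [sq_nonneg (-ξ.2.2 + η.2.2 + 2 * (η.1 * -ξ.2.1 - -ξ.1 * η.2.1))]
  have hx : η.1 = ξ.1 := by
    have : -ξ.1 + η.1 = 0 := by
      refine pow_eq_zero_iff two_ne_zero |>.1 (le_antisymm ?_ (sq_nonneg _))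
      nlinarith [sq_nonneg (-ξ.2.1 + η.2.1)]
    linarith
  have hy : η.2.1 = ξ.2.1 := by
    have : -ξ.2.1 + η.2.1 = 0 := by
      refine pow_eq_zero_iff two_ne_zero |>.1 (le_antisymm ?_ (sq_nonneg _))
      nlinarith [sq_nonneg (-ξ.1 + η.1)]
    linarith
  have ht : η.2.2 = ξ.2.2 := by
    rw [hx, hy] at hle
    have : -ξ.2.2 + η.2.2 = 0 := by
      refine pow_eq_zero_iff two_ne_zero |>.1 (le_antisymm ?_ (sq_nonneg _))
      nlinarith
    linarith
  exact Prod.ext hx (Prod.ext hy ht)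

theorem kd_self (ξ : H1) : kd ξ ξ = 0 := by
  simp [kd, ρH, hmul, hinv, mul_comm]

theorem continuousAt_Γξ {ξ η : H1} (h : η ≠ ξ) : ContinuousAt (Γξ ξ) η := by
  have := kd_pos h
  unfold Γξ
  refine ContinuousAt.div (by fun_prop) (by fun_prop) ?_
  positivity

open Filter Topology in
theorem tendsto_Γξ_atTop (ξ : H1) : Tendsto (Γξ ξ) (𝓝[≠] ξ) atTop := by
  have h : Tendsto (fun η => 8 * π * kd ξ η ^ 2) (𝓝[≠] ξ) (𝓝[>] 0) := by
    refine tendsto_nhdsWithin_iff.2 ⟨?_, ?_⟩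
    · have : ContinuousAt (fun η => 8 * π * kd ξ η ^ 2) ξ := by fun_prop
      simpa [ContinuousAt, kd_self] using this.tendsto.mono_left nhdsWithin_le_nhds
    · filter_upwards [self_mem_nhdsWithin] with η hη
      have := kd_pos hη
      simp only [mem_Ioi]
      positivity
  unfold Γξ
  simp only [one_div]
  exact h.inv_tendsto_nhdsGT_zero

open Filter Topology in
/-- On the boundary of a superlevel set of the Green's function, the Green's function equals
the level. -/
theorem mem_frontier_superlevel {Ω : Set H1} (hΩo : IsOpen Ω) {ξ : H1} (hξ : ξ ∈ Ω) {H : H1 → ℝ}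
    (hHc : ContinuousOn H (closure Ω)) (hHb : ∀ η ∈ frontier Ω, H η = Γξ ξ η)
    {τ : ℝ} (hτ : 0 < τ) {η : H1}
    (hη : η ∈ frontier ({ξ} ∪ {η ∈ Ω \ {ξ} | Γξ ξ η - H η > τ})) :
    η ∈ Ω ∧ η ≠ ξ ∧ Γξ ξ η = τ + H η := by
  have hHat : ∀ q ∈ Ω, ContinuousAt H q := fun q hq =>
    hHc.continuousAt (mem_of_superset (hΩo.mem_nhds hq) subset_closure)
  have hne : η ≠ ξ := by
    rintro rfl
    refine hη.2 (mem_interior_iff_mem_nhds.2 ?_)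
    have hG : Tendsto (fun q => Γξ η q + -H q) (𝓝[≠] η) atTop :=
      tendsto_atTop_add_right_of_le' _ (-H η - 1) (tendsto_Γξ_atTop η) <| by
        filter_upwards [((hHat η hξ).mono_left nhdsWithin_le_nhds).eventually
          (eventually_lt_nhds (lt_add_one (H η)))] with q hq
        linarith
    have hev := hG.eventually_gt_atTop τ
    rw [eventually_nhdsWithin_iff] at hev
    filter_upwards [hev, hΩo.mem_nhds hξ] with q hq hqΩ
    by_cases h : q = η
    · exact Or.inl h
    · exact Or.inr ⟨⟨hqΩ, h⟩, by have := hq h; linarith⟩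
  have hcl : η ∈ closure {η ∈ Ω \ {ξ} | Γξ ξ η - H η > τ} := by
    have := hη.1
    rw [closure_union, closure_singleton] at this
    exact this.resolve_left hne
  have hclΩ : η ∈ closure Ω := closure_mono (fun q hq => hq.1.1) hcl
  have hge : τ ≤ Γξ ξ η - H η := by
    have hc : ContinuousWithinAt (fun q => Γξ ξ q - H q)
        {η ∈ Ω \ {ξ} | Γξ ξ η - H η > τ} η :=
      (continuousAt_Γξ hne).continuousWithinAt.sub
        ((hHc η hclΩ).mono fun q hq => subset_closure hq.1.1)
    have : (𝓝[{η ∈ Ω \ {ξ} | Γξ ξ η - H η > τ}] η).NeBot := mem_closure_iff_nhdsWithin_neBot.1 hcl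
    refine ge_of_tendsto hc ?_
    filter_upwards [self_mem_nhdsWithin] with q hq using hq.2.le
  have hηΩ : η ∈ Ω := by
    by_contra hn
    have := hHb η (hΩo.frontier_eq ▸ ⟨hclΩ, hn⟩)
    linarith
  refine ⟨hηΩ, hne, ?_⟩
  have hle : ¬ τ < Γξ ξ η - H η := by
    intro hlt
    refine hη.2 (mem_interior_iff_mem_nhds.2 ?_)
    have hc : ContinuousAt (fun q => Γξ ξ q - H q) η := (continuousAt_Γξ hne).sub (hHat η hηΩ)
    filter_upwards [hc.eventually (eventually_gt_nhds hlt), hΩo.mem_nhds hηΩ,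
      isOpen_ne.mem_nhds hne] with q h₁ h₂ h₃
    exact Or.inr ⟨⟨h₂, h₃⟩, h₁⟩
  linarith

theorem div_le_div_of_inv_sq_bounds {p q m M a τ : ℝ} (hp : 0 < p) (hq : 0 < q) (hm : 0 < m)
    (hmM : m ≤ M) (ha : 0 < a) (hτ : 0 ≤ τ) (hpM : τ + 1 / (a * M ^ 2) ≤ 1 / (a * p ^ 2))
    (hqm : 1 / (a * q ^ 2) ≤ τ + 1 / (a * m ^ 2)) : p / q ≤ M / m := by
  have hM : 0 < M := hm.trans_le hmM
  have h₁ : p ^ 2 * (1 + τ * a * M ^ 2) ≤ M ^ 2 := by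
    have := mul_le_mul_of_nonneg_right hpM (by positivity : 0 ≤ a * p ^ 2 * M ^ 2)
    field_simp at this
    nlinarith
  have h₂ : m ^ 2 ≤ q ^ 2 * (1 + τ * a * m ^ 2) := by
    have := mul_le_mul_of_nonneg_right hqm (by positivity : 0 ≤ a * q ^ 2 * m ^ 2)
    field_simp at this
    nlinarith
  have hmM2 : m ^ 2 ≤ M ^ 2 := by gcongr
  have hT : 0 ≤ τ * a := by positivity
  have h₃ : (p * m) ^ 2 ≤ (M * q) ^ 2 := by
    have hfac : 0 < 1 + τ * a * m ^ 2 := by positivity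
    have e₁ : p ^ 2 * (1 + τ * a * m ^ 2) ≤ M ^ 2 :=
      le_trans (by gcongr) h₁
    have e₂ : p ^ 2 * m ^ 2 ≤ p ^ 2 * (q ^ 2 * (1 + τ * a * m ^ 2)) := by gcongr
    have e₃ : p ^ 2 * (1 + τ * a * m ^ 2) * q ^ 2 ≤ M ^ 2 * q ^ 2 := by gcongr
    nlinarith
  rw [div_le_div_iff₀ hq hm]
  exact (sq_le_sq₀ (by positivity) (by positivity)).1 h₃

/-- For the level set Ω(τ) = {ξ} ∪ {η ∈ Ω ∖ {ξ} : G_ξ(η) > τ} with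
nonempty boundary, α_{Ω(τ)}(ξ) ≤ α_Ω(ξ), where
α_A(ξ) = (sup_{η∈∂A} d(ξ,η))/(inf_{η∈∂A} d(ξ,η)). -/
theorem level_set_alpha_monotone (Ω : Set H1) (hΩo : IsOpen Ω)
    (hΩb : Bornology.IsBounded Ω)
    (ξ : H1) (hξ : ξ ∈ Ω) (H : H1 → ℝ)
    (hHc : ContinuousOn H (closure Ω)) (hHd : ContDiffOn ℝ 2 H Ω)
    (hHh : ∀ η ∈ Ω, kohn H η = 0)
    (hHb : ∀ η ∈ frontier Ω, H η = Γξ ξ η)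
    (τ : ℝ) (hτ : 0 < τ) :
    let G : H1 → ℝ := fun η => Γξ ξ η - H η
    let Ωτ : Set H1 := {ξ} ∪ {η ∈ Ω \ {ξ} | G η > τ}
    (frontier Ωτ).Nonempty →
    sSup (kd ξ '' frontier Ωτ) / sInf (kd ξ '' frontier Ωτ) ≤
      sSup (kd ξ '' frontier Ω) / sInf (kd ξ '' frontier Ω) := by
  intro G Ωτ hne
  have hΩne : (frontier Ω).Nonempty :=
    nonempty_frontier_iff.2 ⟨⟨ξ, hξ⟩, fun h => NormedSpace.unbounded_univ ℝ H1 (h ▸ hΩb)⟩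
  have hcpt : IsCompact (frontier Ω) := hΩb.isCompact_closure.of_isClosed_subset
    isClosed_frontier frontier_subset_closure
  have hcptτ : IsCompact (frontier Ωτ) := by
    have hsub : Ωτ ⊆ Ω := union_subset (singleton_subset_iff.2 hξ) fun q hq => hq.1.1
    exact (hΩb.subset hsub).isCompact_closure.of_isClosed_subset
      isClosed_frontier frontier_subset_closure
  obtain ⟨b, hb, hbM, hbmax⟩ :=
    hcpt.exists_sSup_image_eq_and_ge hΩne (continuous_kd ξ).continuousOn
  obtain ⟨c, hc, hcm, hcmin⟩ :=
    hcpt.exists_sInf_image_eq_and_le hΩne (continuous_kd ξ).continuousOn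
  obtain ⟨p, hp, hpM⟩ := hcptτ.exists_sSup_image_eq hne (continuous_kd ξ).continuousOn
  obtain ⟨q, hq, hqm⟩ := hcptτ.exists_sInf_image_eq hne (continuous_kd ξ).continuousOn
  rw [hbM, hcm, hpM, hqm]
  have hcξ : c ≠ ξ := by
    rintro rfl
    exact (hΩo.frontier_eq ▸ hc).2 hξ
  have hc0 := kd_pos hcξ
  have hupper : ∀ η ∈ Ω, H η ≤ Γξ ξ c :=
    le_of_kohn_nonneg hΩo hΩb hHc hHd (fun η hη => (hHh η hη).ge) fun η hη => by
      rw [hHb η hη]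
      have := hcmin η hη
      unfold Γξ
      gcongr
  have hlower : ∀ η ∈ Ω, Γξ ξ b ≤ H η := fun η hη => neg_le_neg_iff.1 <|
    le_of_kohn_nonneg hΩo hΩb hHc.neg hHd.neg
      (fun η hη => ((kohn_neg H η).trans (by rw [hHh η hη, neg_zero])).ge)
      (fun η hη => by
        rw [Pi.neg_apply, hHb η hη]
        have h₁ := hbmax η hη
        have h₂ := hc0.trans_le (hcmin η hη)
        unfold Γξ
        gcongr) η hη
  obtain ⟨hpΩ, hpξ, hpG⟩ := mem_frontier_superlevel hΩo hξ hHc hHb hτ hp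
  obtain ⟨hqΩ, hqξ, hqG⟩ := mem_frontier_superlevel hΩo hξ hHc hHb hτ hq
  refine div_le_div_of_inv_sq_bounds (a := 8 * π) (kd_pos hpξ) (kd_pos hqξ) hc0 (hcmin b hb)
    (by positivity) hτ.le ?_ ?_
  · have := hlower p hpΩ
    change τ + Γξ ξ b ≤ Γξ ξ p
    linarith
  · have := hupper q hqΩ
    change Γξ ξ q ≤ τ + Γξ ξ c
    linarith
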